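/- Let L be a Leibniz algebra over a field 𝕜 with left center Z, and let Θ ∈ C̃³(L) be the canonical 3-cochain. Then for every representable cochain η ∈ C̃^m(L), the bracket with Θ recovers the differential up to sign: {Θ, η} = −dη. -/

import Mathlib

open scoped TensorProduct

universe u v w

/-- A (left) Leibniz algebra over a field `𝕜`. -/
structure LeibnizAlg (𝕜 : Type u) [Field 𝕜] (L : Type v) [AddCommGroup L] [Module 𝕜 L] where
  br : L →ₗ[𝕜] L →ₗ[𝕜] L
  leibniz : ∀ a b c : L, br a (br b c) = br (br a b) c + br b (br a c)

namespace LeibnizAlg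

variable {𝕜 : Type u} [Field 𝕜] {L : Type v} [AddCommGroup L] [Module 𝕜 L]
variable (A : LeibnizAlg 𝕜 L)

/-- The left center `Z = {z | z ∘ e = 0 for all e}`. -/
def leftCenter : Submodule 𝕜 L where
  carrier := {z | ∀ e : L, A.br z e = 0}
  add_mem' := by
    intro a b ha hb
    simp only [Set.mem_setOf_eq] at *
    intro e
    rw [map_add, LinearMap.add_apply, ha e, hb e, add_zero]
  zero_mem' := by
    simp only [Set.mem_setOf_eq]
    intro e
    rw [map_zero, LinearMap.zero_apply]
  smul_mem' := by
    intro c x hx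
    simp only [Set.mem_setOf_eq] at *
    intro e
    rw [map_smul, LinearMap.smul_apply, hx e, smul_zero]

lemma mem_leftCenter_iff {z : L} : z ∈ A.leftCenter ↔ ∀ e : L, A.br z e = 0 := Iff.rfl

/-- The symmetric product `(a,b) = a∘b + b∘a`. -/
def sp (a b : L) : L := A.br a b + A.br b a

lemma sp_mem (a b : L) : A.sp a b ∈ A.leftCenter := by
  rw [mem_leftCenter_iff]
  intro e
  have h1 := A.leibniz a b e
  have h2 := A.leibniz b a e
  have hx : A.br (A.br a b) e = A.br a (A.br b e) - A.br b (A.br a e) :=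
    eq_sub_iff_add_eq.mpr h1.symm
  have hy : A.br (A.br b a) e = A.br b (A.br a e) - A.br a (A.br b e) :=
    eq_sub_iff_add_eq.mpr h2.symm
  rw [sp, map_add, LinearMap.add_apply, hx, hy]
  abel

/-- The symmetric product, seen as valued in the left center. -/
def spZ (a b : L) : A.leftCenter := ⟨A.sp a b, A.sp_mem a b⟩

lemma br_mem (e : L) (f : A.leftCenter) : A.br e (f : L) ∈ A.leftCenter := by
  rw [mem_leftCenter_iff]
  intro e'
  have h := A.leibniz e (f : L) e'
  have hf : A.br (f : L) e' = 0 := (A.mem_leftCenter_iff.mp f.2) e'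
  have hf2 : A.br (f : L) (A.br e e') = 0 := (A.mem_leftCenter_iff.mp f.2) _
  rw [hf] at h
  rw [map_zero] at h
  rw [hf2, add_zero] at h
  exact h.symm

/-- The bracket of `L` on its left center. -/
def brZ (e : L) (f : A.leftCenter) : A.leftCenter := ⟨A.br e (f : L), A.br_mem e f⟩

/-- The symmetric product as a bilinear map into the left center. -/
noncomputable def spL : L →ₗ[𝕜] L →ₗ[𝕜] A.leftCenter :=
  LinearMap.mk₂ 𝕜 A.spZ
    (fun a a' b => Subtype.ext (by
      simp only [spZ, sp, map_add, LinearMap.add_apply, Submodule.coe_add]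
      abel))
    (fun c a b => Subtype.ext (by
      simp only [spZ, sp, map_smul, LinearMap.smul_apply, SetLike.val_smul, smul_add]))
    (fun a b b' => Subtype.ext (by
      simp only [spZ, sp, map_add, LinearMap.add_apply, Submodule.coe_add]
      abel))
    (fun c a b => Subtype.ext (by
      simp only [spZ, sp, map_smul, LinearMap.smul_apply, SetLike.val_smul, smul_add]))

end LeibnizAlg

/-- `(S, ι)` is (a model of) the symmetric algebra of the module `Z`:
it satisfies the universal property. -/
def IsSymAlg {𝕜 : Type u} [Field 𝕜] {Z : Type v} [AddCommGroup Z] [Module 𝕜 Z]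
    (S : Type w) [CommRing S] [Algebra 𝕜 S] (ι : Z →ₗ[𝕜] S) : Prop :=
  ∀ (B : Type (max u v w)) [CommRing B] [Algebra 𝕜 B] (g : Z →ₗ[𝕜] B),
    ∃! h : S →ₐ[𝕜] B, ∀ z : Z, h (ι z) = g z

section Shuffles

/-- All ways of splitting a list into a signed pair of complementary subsequences. -/
def shSplits {α : Type*} : List α → List (ℤ × List α × List α)
  | [] => [(1, [], [])]
  | a :: l =>
      ((shSplits l).map fun t => (t.1, a :: t.2.1, t.2.2)) ++
      ((shSplits l).map fun t => ((-1) ^ t.2.1.length * t.1, t.2.1, a :: t.2.2))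

/-- Signed sum over all `(p, l.length - p)`-shuffles of the list `l`. -/
def shSum {α : Type*} {S : Type*} [AddCommGroup S] (p : ℕ) (l : List α)
    (F : List α → List α → S) : S :=
  (((shSplits l).filter fun t => t.2.1.length == p).map fun t => t.1 • F t.2.1 t.2.2).sum

/-- Unsigned sum over all `(p, l.length - p)`-shuffles of the list `l`. -/
def shSumU {α : Type*} {S : Type*} [AddCommMonoid S] (p : ℕ) (l : List α)
    (F : List α → List α → S) : S :=
  (((shSplits l).filter fun t => t.2.1.length == p).map fun t => F t.2.1 t.2.2).sum

end Shuffles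

section Cochains

variable {𝕜 : Type u} [Field 𝕜] {L : Type v} [AddCommGroup L] [Module 𝕜 L]
variable (A : LeibnizAlg 𝕜 L)
variable (S : Type w) [CommRing S] [Algebra 𝕜 S]
variable (ι : A.leftCenter →ₗ[𝕜] S)

/-- `ω` is an `n`-cochain in the standard complex `C(L) = C(L, Z, S^•(Z))`:
its component `ω k`, defined on tuples `es` of `n - 2k` elements of `L` and `k`
elements of the left center, is multilinear, symmetric in the `Z`-arguments, and
weakly skew-symmetric in the `L`-arguments. -/
structure IsCochain (n : ℕ) (ω : ℕ → List L → List A.leftCenter → S) : Prop where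
  add_e : ∀ (k : ℕ) (p q : List L) (x y : L) (fs : List A.leftCenter),
    2*k + (p.length + 1 + q.length) = n → fs.length = k →
    ω k (p ++ (x + y) :: q) fs = ω k (p ++ x :: q) fs + ω k (p ++ y :: q) fs
  smul_e : ∀ (k : ℕ) (p q : List L) (c : 𝕜) (x : L) (fs : List A.leftCenter),
    2*k + (p.length + 1 + q.length) = n → fs.length = k →
    ω k (p ++ (c • x) :: q) fs = c • ω k (p ++ x :: q) fs
  add_f : ∀ (k : ℕ) (es : List L) (p q : List A.leftCenter) (x y : A.leftCenter),
    2*k + es.length = n → p.length + 1 + q.length = k →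
    ω k es (p ++ (x + y) :: q) = ω k es (p ++ x :: q) + ω k es (p ++ y :: q)
  smul_f : ∀ (k : ℕ) (es : List L) (p q : List A.leftCenter) (c : 𝕜) (x : A.leftCenter),
    2*k + es.length = n → p.length + 1 + q.length = k →
    ω k es (p ++ (c • x) :: q) = c • ω k es (p ++ x :: q)
  symm_f : ∀ (k : ℕ) (es : List L) (p q : List A.leftCenter) (x y : A.leftCenter),
    2*k + es.length = n → p.length + 2 + q.length = k →
    ω k es (p ++ x :: y :: q) = ω k es (p ++ y :: x :: q)
  skew : ∀ (k : ℕ) (p q : List L) (x y : L) (fs : List A.leftCenter),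
    2*k + (p.length + 2 + q.length) = n → fs.length = k →
    ω k (p ++ x :: y :: q) fs + ω k (p ++ y :: x :: q) fs
      = - ω (k+1) (p ++ q) (A.spZ x y :: fs)

/-- The product of an `n`-cochain and an `m`-cochain. -/
def cmul (n m : ℕ) (ω η : ℕ → List L → List A.leftCenter → S) :
    ℕ → List L → List A.leftCenter → S :=
  fun k es fs => ∑ i ∈ Finset.range (k+1),
    if 2*i ≤ n ∧ 2*(k-i) ≤ m then
      shSum (n - 2*i) es fun es₁ es₂ =>
        shSumU i fs fun fs₁ fs₂ => ω i es₁ fs₁ * η (k-i) es₂ fs₂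
    else 0

/-- The operator `d₀` of the standard complex, where `ρ` is the action of `L` on
`S^•(Z)` by derivations. -/
def cd0 (ρ : L → Derivation 𝕜 S S) (ω : ℕ → List L → List A.leftCenter → S) :
    ℕ → List L → List A.leftCenter → S :=
  fun k es fs =>
    (∑ a ∈ Finset.range es.length,
      (-1 : ℤ)^a • ρ (es.getD a 0) (ω k (es.eraseIdx a) fs))
    + ∑ a ∈ Finset.range es.length, ∑ b ∈ Finset.Ico (a+1) es.length,
        (-1 : ℤ)^(a+1) •
          ω k ((es.eraseIdx a).set (b-1) (A.br (es.getD a 0) (es.getD b 0))) fs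

/-- The operator `δ` of the standard complex. -/
def cdel (ω : ℕ → List L → List A.leftCenter → S) :
    ℕ → List L → List A.leftCenter → S :=
  fun k es fs => ∑ j ∈ Finset.range fs.length,
    ω (k-1) (((fs.getD j 0 : A.leftCenter) : L) :: es) (fs.eraseIdx j)

/-- The symmetric product with values pushed into `S = S^•(Z)`. -/
noncomputable def spS : L →ₗ[𝕜] L →ₗ[𝕜] S := (A.spL).compr₂ ι

/-- The `S^•(Z)`-bilinear extension of the symmetric product to `S^•(Z) ⊗ L`. -/
noncomputable def pairT : (S ⊗[𝕜] L) →ₗ[𝕜] (S ⊗[𝕜] L) →ₗ[𝕜] S :=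
  TensorProduct.curry <|
    (TensorProduct.lift (LinearMap.mul 𝕜 S)).comp <|
      (TensorProduct.map (TensorProduct.lift (LinearMap.mul 𝕜 S))
        (TensorProduct.lift (spS A S ι))).comp
        (TensorProduct.tensorTensorTensorComm 𝕜 S L S L).toLinearMap

/-- `ω` is a representable `n`-cochain: each of the maps
`e ↦ ω k (es ++ [e]) fs` lies in the image of `φ = pairT`. -/
def IsRepr (n : ℕ) (ω : ℕ → List L → List A.leftCenter → S) : Prop :=
  ∀ (k : ℕ) (es : List L) (fs : List A.leftCenter),
    2*k + (es.length + 1) = n → fs.length = k →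
    ∃ x : S ⊗[𝕜] L, ∀ e : L, pairT A S ι x ((1 : S) ⊗ₜ[𝕜] e) = ω k (es ++ [e]) fs

/-- `ωt` is a choice of `φ`-preimages `ω̃` for the representable cochain `ω`. -/
def IsPre (n : ℕ) (ω : ℕ → List L → List A.leftCenter → S)
    (ωt : ℕ → List L → List A.leftCenter → S ⊗[𝕜] L) : Prop :=
  ∀ (k : ℕ) (es : List L) (fs : List A.leftCenter),
    2*k + (es.length + 1) = n → fs.length = k →
    ∀ e : L, pairT A S ι (ωt k es fs) ((1 : S) ⊗ₜ[𝕜] e) = ω k (es ++ [e]) fs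

/-- `ωc k es x fs` is the extension `ω̌` of `ω (k+1) es (·::fs)` from `Z` to all of
`S = S^•(Z)` in its first `Z`-slot, by the Leibniz rule. -/
structure IsExt (n : ℕ) (ω : ℕ → List L → List A.leftCenter → S)
    (ωc : ℕ → List L → S → List A.leftCenter → S) : Prop where
  on_gen : ∀ (k : ℕ) (es : List L) (fs : List A.leftCenter) (f : A.leftCenter),
    2*(k+1) + es.length = n → fs.length = k →
    ωc k es (ι f) fs = ω (k+1) es (f :: fs)
  map_add : ∀ (k : ℕ) (es : List L) (fs : List A.leftCenter) (x y : S),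
    2*(k+1) + es.length = n → fs.length = k →
    ωc k es (x + y) fs = ωc k es x fs + ωc k es y fs
  map_smul : ∀ (k : ℕ) (es : List L) (fs : List A.leftCenter) (c : 𝕜) (x : S),
    2*(k+1) + es.length = n → fs.length = k →
    ωc k es (c • x) fs = c • ωc k es x fs
  mul_rule : ∀ (k : ℕ) (es : List L) (fs : List A.leftCenter) (x y : S),
    2*(k+1) + es.length = n → fs.length = k →
    ωc k es (x * y) fs = x * ωc k es y fs + y * ωc k es x fs

/-- The operation `ω ◇ η` built from the Leibniz-rule extension `ωc` of `ω`. -/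
def cdiam (n m : ℕ) (ωc : ℕ → List L → S → List A.leftCenter → S)
    (η : ℕ → List L → List A.leftCenter → S) : ℕ → List L → List A.leftCenter → S :=
  fun k es fs => ∑ i ∈ Finset.range (k+1),
    if 2*(i+1) ≤ n ∧ 2*(k-i) ≤ m then
      shSum (n - 2*i - 2) es fun es₁ es₂ =>
        shSumU (k-i) fs fun fs₁ fs₂ => ωc i es₁ (η (k-i) es₂ fs₁) fs₂
    else 0

/-- The operation `ω • η` built from chosen `φ`-preimages `ωt`, `ηt`. -/
noncomputable def cbull (n m : ℕ)
    (ωt ηt : ℕ → List L → List A.leftCenter → S ⊗[𝕜] L) :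
    ℕ → List L → List A.leftCenter → S :=
  fun k es fs => (-1 : ℤ)^(m-1) • ∑ i ∈ Finset.range (k+1),
    if 2*i + 1 ≤ n ∧ 2*(k-i) + 1 ≤ m then
      shSum (n - 2*i - 1) es fun es₁ es₂ =>
        shSumU i fs fun fs₁ fs₂ => pairT A S ι (ωt i es₁ fs₁) (ηt (k-i) es₂ fs₂)
    else 0

/-- The bracket `{ω, η} = ω•η + ω◇η − (−1)^{nm} η◇ω` of representable cochains. -/
noncomputable def cpbr (n m : ℕ)
    (ω η : ℕ → List L → List A.leftCenter → S)
    (ωt ηt : ℕ → List L → List A.leftCenter → S ⊗[𝕜] L)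
    (ωc ηc : ℕ → List L → S → List A.leftCenter → S) :
    ℕ → List L → List A.leftCenter → S :=
  fun k es fs => cbull A S ι n m ωt ηt k es fs + cdiam A S n m ωc η k es fs
    - (-1 : ℤ)^(n*m) • cdiam A S m n ηc ω k es fs

/-- The canonical 3-cochain `Θ`. -/
def ThetaC : ℕ → List L → List A.leftCenter → S :=
  fun k es fs => match k, es, fs with
    | 0, [e₁, e₂, e₃], [] => ι (A.spZ (A.br e₁ e₂) e₃)
    | 1, [e], [f] => - ι (A.spZ e (f : L))
    | _, _, _ => 0

/-- The 2-cochain `ζ` with `ζ₀ = (·,·)` and `ζ₁(f) = −2f`. -/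
def zetaC : ℕ → List L → List A.leftCenter → S :=
  fun k es fs => match k, es, fs with
    | 0, [e₁, e₂], [] => ι (A.spZ e₁ e₂)
    | 1, [], [f] => (-2 : 𝕜) • ι f
    | _, _, _ => 0

/-- The representable 1-cochain `e^♭ = (e, ·)`. -/
def eflat (e : L) : ℕ → List L → List A.leftCenter → S :=
  fun k es fs => match k, es, fs with
    | 0, [e'], [] => ι (A.spZ e e')
    | _, _, _ => 0

end Cochains

section ShuffleSums

variable {α : Type*} {S : Type*} [AddCommGroup S]

/-- Signed sum over the splittings of `l` whose second part has `q` elements. -/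
def shSumR : ℕ → List α → (List α → List α → S) → S
  | 0, l, F => F l []
  | _ + 1, [], _ => 0
  | q + 1, a :: l, F =>
      shSumR (q + 1) l (fun x y => F (a :: x) y) +
        (-1 : ℤ) ^ (l.length + q) • shSumR q l (fun x y => F x (a :: y))

lemma length_add_length_of_mem_shSplits {l : List α} :
    ∀ {t : ℤ × List α × List α}, t ∈ shSplits l →
      t.2.1.length + t.2.2.length = l.length := by
  induction l with
  | nil => simp [shSplits]
  | cons a l ih =>
    intro t ht
    simp only [shSplits, List.mem_append, List.mem_map] at ht
    rcases ht with ⟨s, hs, rfl⟩ | ⟨s, hs, rfl⟩ <;> have := ih hs <;> simp <;> omega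

lemma shSum_congr {p : ℕ} {l : List α} {F G : List α → List α → S}
    (h : ∀ x y, x.length = p → x.length + y.length = l.length → F x y = G x y) :
    shSum p l F = shSum p l G := by
  unfold shSum
  congr 1
  refine List.map_congr_left fun t ht => ?_
  rw [List.mem_filter] at ht
  rw [h _ _ (by simpa using ht.2) (length_add_length_of_mem_shSplits ht.1)]

lemma shSum_nil_succ (p : ℕ) (F : List α → List α → S) : shSum (p + 1) [] F = 0 := by
  simp [shSum, shSplits]

lemma shSum_succ_cons (p : ℕ) (a : α) (l : List α) (F : List α → List α → S) :
    shSum (p + 1) (a :: l) F = shSum p l (fun x y => F (a :: x) y) +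
      (-1 : ℤ) ^ (p + 1) • shSum (p + 1) l (fun x y => F x (a :: y)) := by
  simp only [shSum, shSplits, List.filter_append, List.map_append, List.sum_append,
    List.filter_map, List.map_map, Function.comp_def, List.length_cons, List.smul_sum]
  congr 1
  · simp
  · congr 1
    refine List.map_congr_left fun t ht => ?_
    have : t.2.1.length = p + 1 := by simpa using (List.mem_filter.mp ht).2
    rw [this, mul_smul]

lemma shSum_zero (l : List α) (F : List α → List α → S) : shSum 0 l F = F [] l := by
  induction l generalizing F with
  | nil => simp [shSum, shSplits]
  | cons a l ih =>
    have := ih fun x y => F x (a :: y)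
    rw [← this]
    simp only [shSum, shSplits, List.filter_append, List.map_append, List.sum_append,
      List.filter_map, List.map_map, Function.comp_def, List.length_cons]
    simp only [List.filter_false, List.map_nil, List.sum_nil,
      zero_add, beq_eq_false_iff_ne.mpr (Nat.succ_ne_zero _)]
    congr 1
    refine List.map_congr_left fun t ht => ?_
    have : t.2.1.length = 0 := by simpa using (List.mem_filter.mp ht).2
    simp [this]

lemma shSum_eq_zero {p : ℕ} {l : List α} (h : l.length < p) (F : List α → List α → S) :
    shSum p l F = 0 := by
  induction l generalizing p F with
  | nil =>
    obtain _ | p := p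
    · simp at h
    · exact shSum_nil_succ p F
  | cons a l ih =>
    obtain _ | p := p
    · simp at h
    · rw [List.length_cons] at h
      rw [shSum_succ_cons, ih (by omega), ih (by omega), smul_zero, add_zero]

lemma shSumR_eq_zero {q : ℕ} {l : List α} (h : l.length < q) (F : List α → List α → S) :
    shSumR q l F = 0 := by
  induction l generalizing q F with
  | nil =>
    obtain _ | q := q
    · simp at h
    · rfl
  | cons a l ih =>
    obtain _ | q := q
    · simp at h
    · rw [List.length_cons] at h
      rw [shSumR, ih (by omega), ih (by omega), smul_zero, add_zero]

lemma shSum_eq_shSumR {p q : ℕ} {l : List α} (h : p + q = l.length)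
    (F : List α → List α → S) : shSum p l F = shSumR q l F := by
  induction l generalizing p q F with
  | nil =>
    obtain ⟨rfl, rfl⟩ : p = 0 ∧ q = 0 := by simpa using h
    rw [shSum_zero, shSumR]
  | cons a l ih =>
    rw [List.length_cons] at h
    obtain _ | p := p
    · obtain rfl : q = l.length + 1 := by omega
      rw [shSum_zero, shSumR, shSumR_eq_zero (by omega), ← ih (p := 0) (by omega), shSum_zero,
        (Even.add_self _).neg_one_pow, one_smul, zero_add]
    · obtain _ | q := q
      · rw [shSum_succ_cons, shSum_eq_zero (p := p + 1) (by omega), smul_zero, add_zero,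
          ih (q := 0) (by omega), shSumR, shSumR]
      · rw [shSum_succ_cons, shSumR, ih (q := q + 1) (by omega), ih (q := q) (by omega)]
        obtain rfl : p = l.length - q - 1 := by omega
        congr 2
        rw [show l.length + q = (l.length - q - 1 + 1) + (q + q) by omega,
          pow_add (-1 : ℤ) _ (q + q), (Even.add_self q).neg_one_pow, mul_one]

lemma shSumR_sum {κ : Type*} (s : Finset κ) (q : ℕ) (l : List α)
    (F : κ → List α → List α → S) :
    shSumR q l (fun x y => ∑ j ∈ s, F j x y) = ∑ j ∈ s, shSumR q l (F j) := by
  induction l generalizing q F with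
  | nil => cases q <;> simp [shSumR]
  | cons a l ih =>
    cases q with
    | zero => simp [shSumR]
    | succ q => simp only [shSumR, ih, Finset.sum_add_distrib, Finset.smul_sum]

lemma shSumR_neg (q : ℕ) (l : List α) (F : List α → List α → S) :
    shSumR q l (fun x y => - F x y) = - shSumR q l F := by
  induction l generalizing q F with
  | nil => cases q <;> simp [shSumR]
  | cons a l ih =>
    cases q with
    | zero => simp [shSumR]
    | succ q => simp only [shSumR, ih, smul_neg, neg_add]

lemma shSum_one (d : α) (l : List α) (F : List α → List α → S) :
    shSum 1 l F = ∑ a ∈ Finset.range l.length,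
      (-1 : ℤ) ^ a • F [l.getD a d] (l.eraseIdx a) := by
  induction l generalizing F with
  | nil => simpa using shSum_nil_succ 0 F
  | cons e l ih =>
    rw [shSum_succ_cons, shSum_zero, ih, List.length_cons, Finset.sum_range_succ', add_comm,
      Finset.smul_sum]
    congr 1
    · refine Finset.sum_congr rfl fun a _ => ?_
      simp [pow_succ]
    · simp

lemma shSumU_zero (l : List α) (F : List α → List α → S) : shSumU 0 l F = F [] l := by
  induction l generalizing F with
  | nil => simp [shSumU, shSplits]
  | cons a l ih =>
    rw [← ih fun x y => F x (a :: y)]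
    simp only [shSumU, shSplits, List.filter_append, List.map_append, List.sum_append,
      List.filter_map, List.map_map, Function.comp_def, List.length_cons]
    simp

lemma shSumU_succ_cons (p : ℕ) (a : α) (l : List α) (F : List α → List α → S) :
    shSumU (p + 1) (a :: l) F = shSumU p l (fun x y => F (a :: x) y) +
      shSumU (p + 1) l (fun x y => F x (a :: y)) := by
  simp only [shSumU, shSplits, List.filter_append, List.map_append, List.sum_append,
    List.filter_map, List.map_map, Function.comp_def, List.length_cons]
  simp

lemma shSumU_eq_zero {p : ℕ} {l : List α} (h : l.length < p) (F : List α → List α → S) :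
    shSumU p l F = 0 := by
  induction l generalizing p F with
  | nil =>
    obtain _ | p := p
    · simp at h
    · simp [shSumU, shSplits]
  | cons a l ih =>
    obtain _ | p := p
    · simp at h
    · rw [List.length_cons] at h
      rw [shSumU_succ_cons, ih (by omega), ih (by omega), add_zero]

lemma shSumU_length {p : ℕ} {l : List α} (h : l.length = p) (F : List α → List α → S) :
    shSumU p l F = F l [] := by
  induction l generalizing p F with
  | nil => subst h; exact shSumU_zero _ _
  | cons a l ih =>
    obtain rfl : p = l.length + 1 := by simpa using h.symm
    rw [shSumU_succ_cons, ih rfl, shSumU_eq_zero (by omega), add_zero]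

lemma shSumU_one (d : α) (l : List α) (F : List α → List α → S) :
    shSumU 1 l F = ∑ j ∈ Finset.range l.length, F [l.getD j d] (l.eraseIdx j) := by
  induction l generalizing F with
  | nil => simp [shSumU, shSplits]
  | cons e l ih =>
    rw [shSumU_succ_cons, shSumU_zero, ih, List.length_cons, Finset.sum_range_succ', add_comm]
    simp

/-- Weak skew-symmetry on lists of length `n`, with defect `G`. -/
def WeakSkew (n : ℕ) (H : List α → S) (G : List α → α → α → S) : Prop :=
  ∀ (p q : List α) (x y : α), p.length + 2 + q.length = n →
    H (p ++ x :: y :: q) + H (p ++ y :: x :: q) = - G (p ++ q) x y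

lemma WeakSkew.cons {n : ℕ} {H : List α → S} {G : List α → α → α → S}
    (h : WeakSkew (n + 1) H G) (e : α) :
    WeakSkew n (fun l => H (e :: l)) (fun l => G (e :: l)) := fun p q x y hn =>
  h (e :: p) q x y (by rw [List.length_cons]; omega)

/-- Moving the first entry of a list to its end. -/
lemma WeakSkew.rotate {d : α} {l : List α} {H : List α → S} {G : List α → α → α → S}
    (h : WeakSkew (l.length + 1) H G) (x : α) :
    H (x :: l) = (-1 : ℤ) ^ l.length • (H (l ++ [x]) +
      shSumR 1 l fun y z => G y x (z.getD 0 d)) := by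
  induction l generalizing H G with
  | nil => simp [shSumR]
  | cons e l ih =>
    have h₁ := h [] l x e (by simp; omega)
    have h₂ := ih (h.cons e)
    simp only [List.nil_append] at h₁
    rw [eq_sub_of_add_eq h₁, h₂]
    obtain hs | hs := neg_one_pow_eq_or ℤ l.length <;>
    · simp only [shSumR, List.length_cons, List.cons_append, List.getD_cons_zero, add_zero,
        pow_succ, hs, mul_neg, mul_one, neg_smul, neg_neg, one_smul]
      abel

/-- Replacing an entry by its image and moving it to the end. -/
lemma WeakSkew.sum_set {d : α} {l : List α} {H : List α → S} {G : List α → α → α → S}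
    (h : WeakSkew l.length H G) (f : α → α) :
    ∑ b ∈ Finset.range l.length, H (l.set b (f (l.getD b d))) =
      - ((-1 : ℤ) ^ l.length • shSum 1 l fun x y => H (y ++ [f (x.getD 0 d)])) -
        shSumR 2 l fun y z => G y (f (z.getD 0 d)) (z.getD 1 d) := by
  induction l generalizing H G with
  | nil => simp [shSumR, shSum_nil_succ]
  | cons e l ih =>
    have h₁ := h.rotate (d := d) (f e)
    have h₂ := ih (h.cons e)
    rw [List.length_cons, Finset.sum_range_succ']
    simp only [List.set_cons_succ, List.set_cons_zero, List.getD_cons_succ, List.getD_cons_zero]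
    rw [h₂, h₁, shSum_succ_cons, shSum_zero]
    simp only [shSumR, pow_succ, List.cons_append, List.getD_cons_zero, List.getD_cons_succ,
      pow_zero,
      mul_neg, mul_one, neg_smul, smul_add, smul_neg, neg_neg, one_smul]
    abel

/-- Contracting two entries by `f` at the place of the second, compared with contracting them
at the end. -/
lemma WeakSkew.sum_contract {d : α} {l : List α} {H : List α → S} {G : List α → α → α → S}
    (h : WeakSkew (l.length - 1) H G) (f : α → α → α) :
    ∑ a ∈ Finset.range l.length, ∑ b ∈ Finset.Ico (a + 1) l.length,
        (-1 : ℤ) ^ (a + 1) • H ((l.eraseIdx a).set (b - 1) (f (l.getD a d) (l.getD b d))) =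
      - ((-1 : ℤ) ^ l.length • ((shSum 2 l fun x y => H (y ++ [f (x.getD 0 d) (x.getD 1 d)])) +
        shSumR 3 l fun y z => G y (f (z.getD 0 d) (z.getD 1 d)) (z.getD 2 d))) := by
  induction l generalizing H G with
  | nil => simp [shSumR, shSum_nil_succ]
  | cons e l ih =>
    have h₁ := h.sum_set (d := d) (f e)
    have h₂ := ih (H := fun y => H (e :: y)) (G := fun y => G (e :: y)) fun p q x y hn =>
      h (e :: p) q x y (by simp only [List.length_cons]; omega)
    rw [List.length_cons, Finset.sum_range_succ']
    have h₃ : ∀ a ∈ Finset.range l.length, ∑ b ∈ Finset.Ico (a + 1 + 1) (l.length + 1),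
        (-1 : ℤ) ^ (a + 1 + 1) • H (((e :: l).eraseIdx (a + 1)).set (b - 1)
          (f ((e :: l).getD (a + 1) d) ((e :: l).getD b d))) =
        - ∑ b ∈ Finset.Ico (a + 1) l.length, (-1 : ℤ) ^ (a + 1) •
          H (e :: (l.eraseIdx a).set (b - 1) (f (l.getD a d) (l.getD b d))) := by
      intro a _
      rw [← Finset.sum_Ico_add', ← Finset.sum_neg_distrib]
      refine Finset.sum_congr rfl fun b hb => ?_
      obtain ⟨b, rfl⟩ : ∃ c, b = c + 1 := ⟨b - 1, by have := (Finset.mem_Ico.mp hb).1; omega⟩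
      simp [pow_succ]
    have h₄ : ∑ b ∈ Finset.Ico (0 + 1) (l.length + 1),
        (-1 : ℤ) ^ (0 + 1) • H (((e :: l).eraseIdx 0).set (b - 1)
          (f ((e :: l).getD 0 d) ((e :: l).getD b d))) =
        - ∑ b ∈ Finset.range l.length, H (l.set b (f e (l.getD b d))) := by
      rw [← Finset.sum_Ico_add', ← Finset.sum_neg_distrib, Finset.range_eq_Ico]
      exact Finset.sum_congr rfl fun b _ => by simp
    rw [Finset.sum_congr rfl h₃, Finset.sum_neg_distrib, h₂, h₄, h₁, shSum_succ_cons]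
    obtain hs | hs := neg_one_pow_eq_or ℤ l.length <;>
    · simp only [shSumR, List.cons_append, List.getD_cons_zero, List.getD_cons_succ,
        pow_succ, pow_zero, hs, mul_neg, mul_one, neg_smul, neg_neg, one_smul]
      abel

end ShuffleSums

section CanonicalCochain

variable {𝕜 : Type u} [Field 𝕜]

lemma IsSymAlg.adjoin_eq_top {Z : Type v} [AddCommGroup Z] [Module 𝕜 Z]
    {S : Type w} [CommRing S] [Algebra 𝕜 S] {ι : Z →ₗ[𝕜] S} (hS : IsSymAlg S ι) :
    Algebra.adjoin 𝕜 (Set.range ι) = ⊤ := by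
  let T := Algebra.adjoin 𝕜 (Set.range ι)
  let e : ULift.{max u v w} T ≃ₐ[𝕜] T := ULift.algEquiv
  let e' : ULift.{max u v w} S ≃ₐ[𝕜] S := ULift.algEquiv
  let g : Z →ₗ[𝕜] T := ι.codRestrict (Subalgebra.toSubmodule T) fun z =>
    Algebra.subset_adjoin ⟨z, rfl⟩
  obtain ⟨h, hh, -⟩ := hS (ULift.{max u v w} T) (e.symm.toLinearMap.comp g)
  obtain ⟨_, -, huniq⟩ := hS (ULift.{max u v w} S) (e'.symm.toLinearMap.comp ι)
  have hh' : ∀ z, (e (h (ι z)) : S) = ι z := fun z => by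
    rw [hh]
    rfl
  have key : (e'.symm : S →ₐ[𝕜] _).comp (T.val.comp ((e : _ →ₐ[𝕜] T).comp h)) = e'.symm :=
    (huniq _ fun z => by simpa using hh' z).trans (huniq _ fun z => by simp).symm
  rw [eq_top_iff]
  intro s _
  have hs : (e (h s) : S) = s := by simpa using congrArg e' (DFunLike.congr_fun key s)
  rw [← hs]
  exact (e (h s)).2

variable {L : Type v} [AddCommGroup L] [Module 𝕜 L]

namespace LeibnizAlg

variable (A : LeibnizAlg 𝕜 L)

lemma spZ_comm (a b : L) : A.spZ a b = A.spZ b a :=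
  Subtype.ext (add_comm _ _)

lemma spZ_leftCenter (e : L) (f : A.leftCenter) : A.spZ e f = A.brZ e f :=
  Subtype.ext <| by simp [spZ, brZ, sp, A.mem_leftCenter_iff.mp f.2 e]

end LeibnizAlg

variable {A : LeibnizAlg 𝕜 L} {S : Type w} [CommRing S] [Algebra 𝕜 S]
  {ι : A.leftCenter →ₗ[𝕜] S}

lemma pairT_tmul (s t : S) (a b : L) :
    pairT A S ι (s ⊗ₜ a) (t ⊗ₜ b) = s * t * ι (A.spZ a b) := by
  simp [pairT, spS, LeibnizAlg.spL]

lemma pairT_comm (x y : S ⊗[𝕜] L) : pairT A S ι x y = pairT A S ι y x := by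
  induction x with
  | zero => simp
  | add x₁ x₂ h₁ h₂ => simp [h₁, h₂]
  | tmul s a =>
    induction y with
    | zero => simp
    | add y₁ y₂ h₁ h₂ => simp [h₁, h₂]
    | tmul t b => rw [pairT_tmul, pairT_tmul, A.spZ_comm, mul_comm s]

lemma pairT_tmul_right (x : S ⊗[𝕜] L) (s : S) (e : L) :
    pairT A S ι x (s ⊗ₜ e) = s * pairT A S ι x (1 ⊗ₜ e) := by
  induction x with
  | zero => simp
  | add x₁ x₂ h₁ h₂ => simp [h₁, h₂, mul_add]
  | tmul t a => rw [pairT_tmul, pairT_tmul]; ring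

lemma pairT_congr_left {x x' : S ⊗[𝕜] L}
    (h : ∀ e : L, pairT A S ι x (1 ⊗ₜ e) = pairT A S ι x' (1 ⊗ₜ e)) (y : S ⊗[𝕜] L) :
    pairT A S ι x y = pairT A S ι x' y := by
  induction y with
  | zero => simp
  | add y₁ y₂ h₁ h₂ => simp [h₁, h₂]
  | tmul s e => rw [pairT_tmul_right, h, ← pairT_tmul_right]

/-- The extension of `Θ₁ e` by the Leibniz rule is the action of `-e`. -/
lemma IsExt.ThetaC_eq_neg {Θc : ℕ → List L → S → List A.leftCenter → S}
    (hΘc : IsExt A S ι 3 (ThetaC A S ι) Θc) (hS : IsSymAlg S ι) {ρ : L → Derivation 𝕜 S S}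
    (hρ : ∀ (e : L) (f : A.leftCenter), ρ e (ι f) = ι (A.brZ e f)) (e : L) (s : S) :
    Θc 0 [e] s [] = - ρ e s := by
  let φ : S →ₗ[𝕜] S :=
    { toFun := fun s => Θc 0 [e] s []
      map_add' := fun x y => hΘc.map_add 0 [e] [] x y rfl rfl
      map_smul' := fun c x => hΘc.map_smul 0 [e] [] c x rfl rfl }
  let D : Derivation 𝕜 S S := Derivation.mk' φ fun x y => hΘc.mul_rule 0 [e] [] x y rfl rfl
  have hD : D = - ρ e := by
    refine Derivation.ext_of_adjoin_eq_top _ hS.adjoin_eq_top ?_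
    rintro _ ⟨f, rfl⟩
    change Θc 0 [e] (ι f) [] = - ρ e (ι f)
    rw [hΘc.on_gen 0 [e] [] f rfl rfl, hρ, ← A.spZ_leftCenter]
    rfl
  exact DFunLike.congr_fun hD s

lemma IsPre.pairT_ThetaC_zero {Θt : ℕ → List L → List A.leftCenter → S ⊗[𝕜] L}
    (hΘt : IsPre A S ι 3 (ThetaC A S ι) Θt) {n k : ℕ}
    {η : ℕ → List L → List A.leftCenter → S} {ηt : ℕ → List L → List A.leftCenter → S ⊗[𝕜] L}
    (hηt : IsPre A S ι n η ηt) {x y : List L} {fs : List A.leftCenter} (hx : x.length = 2)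
    (hy : 2 * k + (y.length + 1) = n) (hfs : fs.length = k) :
    pairT A S ι (Θt 0 x []) (ηt k y fs) =
      η k (y ++ [A.br (x.getD 0 0) (x.getD 1 0)]) fs := by
  obtain ⟨a, b, rfl⟩ := List.length_eq_two.mp hx
  rw [← hηt k y fs hy hfs, pairT_comm (ηt k y fs)]
  refine pairT_congr_left (fun e => ?_) _
  rw [hΘt 0 [a, b] [] rfl rfl e, pairT_tmul]
  simp [ThetaC]

lemma IsPre.pairT_ThetaC_one {Θt : ℕ → List L → List A.leftCenter → S ⊗[𝕜] L}
    (hΘt : IsPre A S ι 3 (ThetaC A S ι) Θt) {n k : ℕ}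
    {η : ℕ → List L → List A.leftCenter → S} {ηt : ℕ → List L → List A.leftCenter → S ⊗[𝕜] L}
    (hηt : IsPre A S ι n η ηt) {y : List L} (f : A.leftCenter) {fs : List A.leftCenter}
    (hy : 2 * k + (y.length + 1) = n) (hfs : fs.length = k) :
    pairT A S ι (Θt 1 [] [f]) (ηt k y fs) = - η k (y ++ [(f : L)]) fs := by
  rw [← hηt k y fs hy hfs, pairT_comm (ηt k y fs), ← LinearMap.neg_apply, ← map_neg]
  refine pairT_congr_left (fun e => ?_) _
  rw [hΘt 1 [] [f] rfl rfl e, map_neg, LinearMap.neg_apply, pairT_tmul, A.spZ_comm]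
  simp [ThetaC]

lemma IsExt.map_neg_gen {n k : ℕ} {η : ℕ → List L → List A.leftCenter → S}
    {ηc : ℕ → List L → S → List A.leftCenter → S} (hηc : IsExt A S ι n η ηc) {y : List L}
    (f : A.leftCenter) {fs : List A.leftCenter} (hy : 2 * (k + 1) + y.length = n)
    (hfs : fs.length = k) : ηc k y (- ι f) fs = - η (k + 1) y (f :: fs) := by
  rw [← neg_one_smul 𝕜 (ι f), hηc.map_smul k y fs _ _ hy hfs, hηc.on_gen k y fs f hy hfs,
    neg_one_smul]

section Bracket

variable {m k : ℕ} {η : ℕ → List L → List A.leftCenter → S} {es : List L}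
  {fs : List A.leftCenter}

lemma cdiam_ThetaC_left {Θc : ℕ → List L → S → List A.leftCenter → S}
    (hΘc : IsExt A S ι 3 (ThetaC A S ι) Θc) (hS : IsSymAlg S ι) {ρ : L → Derivation 𝕜 S S}
    (hρ : ∀ (e : L) (f : A.leftCenter), ρ e (ι f) = ι (A.brZ e f))
    (hes : 2 * k + es.length = m + 1) (hfs : fs.length = k) :
    cdiam A S 3 m Θc η k es fs = - ∑ a ∈ Finset.range es.length,
      (-1 : ℤ) ^ a • ρ (es.getD a 0) (η k (es.eraseIdx a) fs) := by
  rw [cdiam, Finset.sum_range_succ', Finset.sum_eq_zero fun i _ => if_neg (by omega), zero_add,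
    ← Finset.sum_neg_distrib]
  split_ifs with h
  · rw [show 3 - 2 * 0 - 2 = 1 from rfl, shSum_one 0]
    refine Finset.sum_congr rfl fun a _ => ?_
    rw [shSumU_length (by simpa using hfs), hΘc.ThetaC_eq_neg hS hρ, smul_neg, Nat.sub_zero]
  · obtain rfl : es = [] := List.length_eq_zero_iff.mp (by omega)
    simp

lemma cbull_ThetaC_left {Θt ηt : ℕ → List L → List A.leftCenter → S ⊗[𝕜] L}
    (hΘt : IsPre A S ι 3 (ThetaC A S ι) Θt) (hηt : IsPre A S ι m η ηt)
    (hes : 2 * k + es.length = m + 1) (hfs : fs.length = k) :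
    cbull A S ι 3 m Θt ηt k es fs = (-1 : ℤ) ^ es.length •
      ((shSum 2 es fun x y => η k (y ++ [A.br (x.getD 0 0) (x.getD 1 0)]) fs) -
        ∑ j ∈ Finset.range fs.length,
          η (k - 1) (es ++ [((fs.getD j 0 : A.leftCenter) : L)]) (fs.eraseIdx j)) := by
  have h₀ : (if 2 * 0 + 1 ≤ 3 ∧ 2 * (k - 0) + 1 ≤ m then
      shSum (3 - 2 * 0 - 1) es fun es₁ es₂ => shSumU 0 fs fun fs₁ fs₂ =>
        pairT A S ι (Θt 0 es₁ fs₁) (ηt (k - 0) es₂ fs₂)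
      else 0) = shSum 2 es fun x y => η k (y ++ [A.br (x.getD 0 0) (x.getD 1 0)]) fs := by
    split_ifs with h
    · refine shSum_congr fun x y hx hxy => ?_
      rw [shSumU_zero, Nat.sub_zero, hΘt.pairT_ThetaC_zero hηt hx (by omega) hfs]
    · rw [shSum_eq_zero (by omega)]
  have h_sign : (-1 : ℤ) ^ es.length = (-1 : ℤ) ^ (m + 1) := by
    rw [← hes, pow_add, pow_mul]
    simp
  rw [h_sign]
  obtain _ | k := k
  · obtain rfl : fs = [] := List.length_eq_zero_iff.mp hfs
    rw [cbull, Finset.sum_range_one, h₀]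
    obtain _ | m := m
    · rw [shSum_eq_zero (by omega)]
      simp
    · simp [pow_succ]
  · obtain ⟨m, rfl⟩ : ∃ n, m = n + 1 := ⟨m - 1, by omega⟩
    rw [cbull, Finset.sum_range_succ', h₀, Finset.sum_range_succ',
      Finset.sum_eq_zero fun i _ => if_neg (by omega), zero_add, if_pos (by omega),
      show 3 - 2 * (0 + 1) - 1 = 0 from rfl, shSum_zero, shSumU_one 0, sub_eq_neg_add,
      ← Finset.sum_neg_distrib, show k + 1 - (0 + 1) = k from rfl,
      Finset.sum_congr rfl fun j hj => hΘt.pairT_ThetaC_one hηt (k := k) _ (by omega)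
        (by rw [List.length_eraseIdx_of_lt (Finset.mem_range.mp hj)]; omega)]
    simp [pow_succ]

lemma cdiam_ThetaC_right {ηc : ℕ → List L → S → List A.leftCenter → S}
    (hηc : IsExt A S ι m η ηc) (hes : 2 * k + es.length = m + 1) (hfs : fs.length = k) :
    cdiam A S m 3 ηc (ThetaC A S ι) k es fs =
      (shSumR 3 es fun y z =>
        η (k + 1) y (A.spZ (A.br (z.getD 0 0) (z.getD 1 0)) (z.getD 2 0) :: fs)) -
      ∑ j ∈ Finset.range fs.length, shSumR 1 es fun y z =>
        η k y (A.spZ ((fs.getD j 0 : A.leftCenter) : L) (z.getD 0 0) :: fs.eraseIdx j) := by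
  have h₀ : (if 2 * (k + 1) ≤ m ∧ 2 * (k - k) ≤ 3 then
      shSum (m - 2 * k - 2) es fun es₁ es₂ => shSumU (k - k) fs fun fs₁ fs₂ =>
        ηc k es₁ (ThetaC A S ι (k - k) es₂ fs₁) fs₂
      else 0) = shSumR 3 es fun y z =>
        η (k + 1) y (A.spZ (A.br (z.getD 0 0) (z.getD 1 0)) (z.getD 2 0) :: fs) := by
    rw [Nat.sub_self]
    split_ifs with h
    · rw [← shSum_eq_shSumR (p := m - 2 * k - 2) (by omega)]
      refine shSum_congr fun x y hx hxy => ?_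
      obtain ⟨a, b, c, rfl⟩ := List.length_eq_three.mp (show y.length = 3 by omega)
      rw [shSumU_zero]
      exact hηc.on_gen k x fs _ (by omega) hfs
    · rw [shSumR_eq_zero (by omega)]
  rw [cdiam, Finset.sum_range_succ, h₀]
  obtain _ | k := k
  · obtain rfl : fs = [] := List.length_eq_zero_iff.mp hfs
    simp
  · rw [Finset.sum_range_succ, Finset.sum_eq_zero fun i hi => if_neg (by
      have := Finset.mem_range.mp hi
      omega), zero_add, sub_eq_neg_add, ← shSumR_sum, ← shSumR_neg]
    congr 1
    rw [show k + 1 - k = 1 by omega]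
    split_ifs with h
    · rw [← shSum_eq_shSumR (p := m - 2 * k - 2) (by omega)]
      refine shSum_congr fun x y hx hxy => ?_
      obtain ⟨a, rfl⟩ := List.length_eq_one_iff.mp (show y.length = 1 by omega)
      rw [shSumU_one 0, ← Finset.sum_neg_distrib]
      refine Finset.sum_congr rfl fun j hj => ?_
      rw [A.spZ_comm]
      exact hηc.map_neg_gen _ (by omega)
        (by rw [List.length_eraseIdx_of_lt (Finset.mem_range.mp hj)]; omega)
    · rw [shSumR_eq_zero (by omega)]

lemma IsCochain.weakSkew (hη : IsCochain A S m η) {n : ℕ} (h : 2 * k + n = m)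
    (hfs : fs.length = k) :
    WeakSkew n (fun l => η k l fs) fun l x y => η (k + 1) l (A.spZ x y :: fs) :=
  fun p q x y hn => hη.skew k p q x y fs (by omega) hfs

lemma IsCochain.cdel_eq (hη : IsCochain A S m η) (hes : 2 * k + es.length = m + 1)
    (hfs : fs.length = k) :
    cdel A S η k es fs = (-1 : ℤ) ^ es.length • ∑ j ∈ Finset.range fs.length,
      (η (k - 1) (es ++ [((fs.getD j 0 : A.leftCenter) : L)]) (fs.eraseIdx j) +
        shSumR 1 es fun y z =>
          η k y (A.spZ ((fs.getD j 0 : A.leftCenter) : L) (z.getD 0 0) :: fs.eraseIdx j)) := by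
  rw [cdel, Finset.smul_sum]
  refine Finset.sum_congr rfl fun j hj => ?_
  have hj := Finset.mem_range.mp hj
  obtain ⟨k, rfl⟩ : ∃ i, k = i + 1 := ⟨k - 1, by omega⟩
  exact (hη.weakSkew (k := k) (n := es.length + 1) (fs := fs.eraseIdx j) (by omega)
    (by rw [List.length_eraseIdx_of_lt hj]; omega)).rotate (d := 0) _

end Bracket

end CanonicalCochain

section Theorems

variable {𝕜 : Type u} [Field 𝕜] {L : Type v} [AddCommGroup L] [Module 𝕜 L]

theorem cpbr_Theta (A : LeibnizAlg 𝕜 L) (S : Type w) [CommRing S] [Algebra 𝕜 S]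
    (ι : A.leftCenter →ₗ[𝕜] S) (hS : IsSymAlg S ι)
    (ρ : L → Derivation 𝕜 S S)
    (hρ : ∀ (e : L) (f : A.leftCenter), ρ e (ι f) = ι (A.brZ e f))
    (m : ℕ) (η : ℕ → List L → List A.leftCenter → S) (hη : IsCochain A S m η)
    (Θt : ℕ → List L → List A.leftCenter → S ⊗[𝕜] L)
    (hΘt : IsPre A S ι 3 (ThetaC A S ι) Θt)
    (Θc : ℕ → List L → S → List A.leftCenter → S)
    (hΘc : IsExt A S ι 3 (ThetaC A S ι) Θc)
    (ηt : ℕ → List L → List A.leftCenter → S ⊗[𝕜] L) (hηt : IsPre A S ι m η ηt)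
    (ηc : ℕ → List L → S → List A.leftCenter → S) (hηc : IsExt A S ι m η ηc) :
    ∀ (k : ℕ) (es : List L) (fs : List A.leftCenter),
      2*k + es.length = m + 1 → fs.length = k →
      cpbr A S ι 3 m (ThetaC A S ι) η Θt ηt Θc ηc k es fs
        = - (cd0 A S ρ η k es fs + cdel A S η k es fs) := by
  intro k es fs hes hfs
  have h_contract : ∑ a ∈ Finset.range es.length, ∑ b ∈ Finset.Ico (a + 1) es.length,
      (-1 : ℤ) ^ (a + 1) •
        η k ((es.eraseIdx a).set (b - 1) (A.br (es.getD a 0) (es.getD b 0))) fs = _ :=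
    WeakSkew.sum_contract (d := 0) (H := fun l => η k l fs)
      (G := fun l x y => η (k + 1) l (A.spZ x y :: fs))
      (fun p q x y hn => hη.skew k p q x y fs (by omega) hfs) fun x y => A.br x y
  have h_sign : (-1 : ℤ) ^ (3 * m) = - (-1 : ℤ) ^ es.length := by
    have : (-1 : ℤ) ^ (2 * k + es.length) = (-1 : ℤ) ^ (m + 1) := by rw [hes]
    rw [pow_add, pow_mul, neg_one_sq, one_pow, one_mul] at this
    rw [this, pow_mul]
    norm_num [pow_succ]
  rw [cpbr, cd0, h_contract, hη.cdel_eq hes hfs, cbull_ThetaC_left hΘt hηt hes hfs,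
    cdiam_ThetaC_left hΘc hS hρ hes hfs, cdiam_ThetaC_right hηc hes hfs, h_sign,
    Finset.sum_add_distrib]
  simp only [neg_smul, smul_add, smul_sub]
  abel

end Theorems
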